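/- arXiv:2008.06349 — 2 statements merged into one kernel-verified Lean document; each statement's English description precedes it below -/
import Mathlib

section
/- For every x > 0, the function g(x) := −ρ′(x)/ρ(x), where ρ(x) = log(1 + 1/x) − 1/(x+1), satisfies g(x) = 1/( x(x+1)[(x+1)log(1 + 1/x) − 1] ) and admits the Stieltjes representation g(x) = 1/(x+1) + ∫₀¹ τ₀(t)/(x + t) dt, where τ₀(t) = ( t[(1−t)log((1−t)/t) − 1]² + π² t (1−t)² )^{−1} for 0 < t < 1. -/
open Real in
/-- The density `τ₀(t) = ( t[(1−t)log((1−t)/t) − 1]² + π² t (1−t)² )⁻¹` for `0 < t < 1`. -/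
noncomputable def tau0 (t : ℝ) : ℝ :=
  (t * ((1 - t) * Real.log ((1 - t) / t) - 1) ^ 2 + Real.pi ^ 2 * t * (1 - t) ^ 2)⁻¹

/-- `ρ(x) = log(1 + 1/x) − 1/(x+1)`. -/
noncomputable def rho (x : ℝ) : ℝ := Real.log (1 + 1 / x) - 1 / (x + 1)

/-- `g = −ρ′/ρ`. -/
noncomputable def gfun (x : ℝ) : ℝ := -deriv rho x / rho x

open Filter Topology MeasureTheory

lemma false_of_exp_neg_mul_cos_sin {a b : ℝ} (hb0 : 0 < b) (hbπ : b ≤ Real.pi)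
    (hre : a - 1 = -(Real.exp (-a) * Real.cos b)) (him : b = Real.exp (-a) * Real.sin b) :
    False := by
  have hE : 0 < Real.exp (-a) := Real.exp_pos _
  have hsin : 0 < Real.sin b := by
    by_contra h
    nlinarith
  have hlt : Real.sin b < b := Real.sin_lt hb0
  have ha : a < 0 := by
    have h1 : 1 < Real.exp (-a) := by
      by_contra h
      nlinarith
    linarith [Real.one_lt_exp_iff.mp h1]
  have hmul : a * Real.sin b = Real.sin b - b * Real.cos b := by
    linear_combination Real.sin b * hre + Real.cos b * him
  have hpos : 0 < Real.sin b - b * Real.cos b := by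
    rcases le_or_gt (Real.cos b) 0 with hc | hc
    · nlinarith
    · have hb2 : b < Real.pi / 2 := by
        by_contra h
        exact absurd (Real.cos_nonpos_of_pi_div_two_le_of_le (not_lt.mp h)
          (by linarith [Real.pi_pos])) (not_le.mpr hc)
      have ht := Real.lt_tan hb0 hb2
      rw [Real.tan_eq_sin_div_cos, lt_div_iff₀ hc] at ht
      linarith
  nlinarith

/-- The only zero of `(s - 1) * exp s + 1` in the closed strip `|Im s| ≤ π` is `s = 0`. -/
lemma sub_one_mul_exp_add_one_ne_zero {s : ℂ} (hs : |s.im| ≤ Real.pi) (h0 : s ≠ 0) :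
    (s - 1) * Complex.exp s + 1 ≠ 0 := by
  intro h
  have h1 : s - 1 = -Complex.exp (-s) := by
    rw [Complex.exp_neg]
    field_simp [Complex.exp_ne_zero s]
    linear_combination h
  have hre := congrArg Complex.re h1
  have him := congrArg Complex.im h1
  simp only [Complex.sub_re, Complex.one_re, Complex.neg_re, Complex.exp_re, Complex.neg_im,
    Real.cos_neg, Complex.sub_im, Complex.one_im, sub_zero, Complex.exp_im, Real.sin_neg,
    mul_neg, neg_neg] at hre him
  obtain ⟨hl, hu⟩ := abs_le.mp hs
  rcases lt_trichotomy s.im 0 with hn | hz | hp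
  · refine false_of_exp_neg_mul_cos_sin (a := s.re) (b := -s.im) (by linarith) (by linarith) ?_ ?_
    · rwa [Real.cos_neg]
    · rw [Real.sin_neg]
      linarith
  · rw [hz, Real.cos_zero, mul_one] at hre
    have hr : s.re ≠ 0 := fun hr => h0 (Complex.ext hr hz)
    have := Real.add_one_lt_exp (neg_ne_zero.mpr hr)
    linarith
  · exact false_of_exp_neg_mul_cos_sin hp hu hre him

lemma differentiable_dslope {f : ℂ → ℂ} (hf : Differentiable ℂ f) (c : ℂ) :
    Differentiable ℂ (dslope f c) :=
  differentiableOn_univ.mp ((Complex.differentiableOn_dslope univ_mem).mpr hf.differentiableOn)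

lemma sub_one_mul_exp_add_one_double_zero :
    ∃ q : ℂ → ℂ, Differentiable ℂ q ∧ (∀ s, (s - 1) * Complex.exp s + 1 = s ^ 2 * q s) ∧
      q 0 ≠ 0 := by
  set D : ℂ → ℂ := fun s => (s - 1) * Complex.exp s + 1 with hD
  have hDd : Differentiable ℂ D := by fun_prop
  have hDderiv : ∀ s, HasDerivAt D (s * Complex.exp s) s := fun s =>
    ((((hasDerivAt_id s).sub_const 1).mul (Complex.hasDerivAt_exp s)).add_const 1).congr_deriv
      (by simp only [id]; ring)
  have hq : Differentiable ℂ (dslope (dslope D 0) 0) := differentiable_dslope (differentiable_dslope hDd 0) 0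
  have heq : ∀ s, D s = s ^ 2 * dslope (dslope D 0) 0 s := by
    intro s
    have h1 := sub_smul_dslope D 0 s
    have h2 := sub_smul_dslope (dslope D 0) 0 s
    have h3 : dslope D 0 0 = 0 := by rw [dslope_same, (hDderiv 0).deriv, zero_mul]
    have h4 : D 0 = 0 := by simp [hD]
    rw [h3] at h2
    rw [h4] at h1
    simp only [smul_eq_mul, sub_zero] at h1 h2
    linear_combination -h1 - s * h2
  refine ⟨dslope (dslope D 0) 0, hq, heq, ?_⟩
  set q := dslope (dslope D 0) 0
  have hcont : Continuous (deriv q) := (hq.contDiff (n := 1)).continuous_deriv le_rfl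
  have hext : Complex.exp = fun s => 2 * q s + s * deriv q s := by
    refine Continuous.ext_on (dense_compl_singleton (0 : ℂ)) Complex.continuous_exp
      ((continuous_const.mul hq.continuous).add (continuous_id.mul hcont)) fun s hs => ?_
    have hs0 : s ≠ 0 := hs
    have h1 : HasDerivAt D (2 * s * q s + s ^ 2 * deriv q s) s := by
      have := ((hasDerivAt_pow 2 s).mul (hq s).hasDerivAt)
      rw [show D = fun s => s ^ 2 * q s from funext heq]
      exact this.congr_deriv (by simp)
    have h2 := (hDderiv s).unique h1
    apply mul_left_cancel₀ hs0
    linear_combination h2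
  intro h
  have := congrFun hext 0
  simp [h] at this

lemma exp_eq_ofReal_exp_strip {s : ℂ} {a : ℝ} (hs : |s.im| ≤ Real.pi)
    (h : Complex.exp s = Complex.exp a) : s = a := by
  obtain ⟨n, hn⟩ := Complex.exp_eq_exp_iff_exists_int.mp h
  have him := congrArg Complex.im hn
  simp at him
  rw [him, abs_mul, abs_of_pos Real.two_pi_pos] at hs
  have hn1 : |(n : ℝ)| < 1 := by
    nlinarith [Real.pi_pos]
  have : n = 0 := Int.abs_lt_one_iff.mp (by exact_mod_cast hn1)
  rw [hn, this]
  simp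

/-- The quotient `((exp s - 1)² / ((s - 1) exp s + 1) - C) / (1 + x - x exp s)`, where `C` cancels
the pole at `log (1 + 1 / x)`, extends holomorphically to the closed strip `|Im s| ≤ π`. -/
lemma exists_strip_extension {x : ℝ} (hx : 0 < x) :
    ∃ B : ℂ → ℂ, (∀ s : ℂ, |s.im| ≤ Real.pi → DifferentiableAt ℂ B s) ∧
      ∀ s : ℂ, |s.im| ≤ Real.pi → s ≠ 0 → s ≠ (Real.log (1 + 1 / x) : ℝ) →
        B s = ((Complex.exp s - 1) ^ 2 / ((s - 1) * Complex.exp s + 1) -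
          ((1 / (x * ((x + 1) * Real.log (1 + 1 / x) - 1)) : ℝ) : ℂ)) /
            (1 + x - x * Complex.exp s) := by
  obtain ⟨q, hq, hqD, hq0⟩ := sub_one_mul_exp_add_one_double_zero
  have hqs : ∀ s : ℂ, |s.im| ≤ Real.pi → q s ≠ 0 := by
    intro s hs h
    by_cases h0 : s = 0
    · exact hq0 (h0 ▸ h)
    · exact sub_one_mul_exp_add_one_ne_zero hs h0 (by rw [hqD, h, mul_zero])
  set a : ℝ := Real.log (1 + 1 / x) with ha
  have hx1 : 1 < 1 + 1 / x := by
    have : 0 < 1 / x := by positivity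
    linarith
  have ha0 : 0 < a := Real.log_pos hx1
  have haim : |(a : ℂ).im| ≤ Real.pi := by simp [Real.pi_pos.le]
  have hane : (a : ℂ) ≠ 0 := by exact_mod_cast ha0.ne'
  have hxC : (x : ℂ) ≠ 0 := by exact_mod_cast hx.ne'
  have hea : Complex.exp a = 1 + 1 / x := by
    rw [← Complex.ofReal_exp, ha, Real.exp_log (by linarith)]
    push_cast
    rfl
  set p : ℂ → ℂ := dslope (fun s => Complex.exp s - 1) 0
  have hp : Differentiable ℂ p := differentiable_dslope (by fun_prop) 0
  have hpe : ∀ s, Complex.exp s - 1 = s * p s := by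
    intro s
    have := sub_smul_dslope (fun s => Complex.exp s - 1) 0 s
    simp only [smul_eq_mul, sub_zero, Complex.exp_zero, sub_self] at this
    exact this.symm
  set A : ℂ → ℂ := fun s => p s ^ 2 / q s with hA
  have hAe : ∀ s : ℂ, |s.im| ≤ Real.pi → s ≠ 0 →
      A s = (Complex.exp s - 1) ^ 2 / ((s - 1) * Complex.exp s + 1) := by
    intro s hs h0
    have := hqs s hs
    rw [hpe, hqD, hA]
    field_simp
  have hAa : A a = ((1 / (x * ((x + 1) * a - 1)) : ℝ) : ℂ) := by
    have hne := sub_one_mul_exp_add_one_ne_zero haim hane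
    rw [hAe a haim hane]
    rw [hea] at hne ⊢
    have hne2 : ((x : ℂ) + 1) * a - 1 ≠ 0 := by
      intro h
      apply hne
      field_simp
      linear_combination h
    push_cast
    rw [div_eq_div_iff hne (mul_ne_zero hxC hne2)]
    field_simp
    ring
  set U : Set ℂ := {s | q s ≠ 0}
  have hU : IsOpen U := isOpen_ne_fun hq.continuous continuous_const
  have hAd : DifferentiableOn ℂ A U := fun s hs =>
    (((hp s).pow 2).div (hq s) hs).differentiableWithinAt
  have hAd' : DifferentiableOn ℂ (dslope A a) U :=
    (Complex.differentiableOn_dslope (hU.mem_nhds (hqs a haim))).mpr hAd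
  set e : ℂ → ℂ := dslope Complex.exp a
  have he : Differentiable ℂ e := differentiable_dslope Complex.differentiable_exp a
  have hes : ∀ s : ℂ, |s.im| ≤ Real.pi → e s ≠ 0 := by
    intro s hs h
    by_cases hsa : s = a
    · rw [hsa] at h
      simp only [e, dslope_same, Complex.deriv_exp] at h
      exact Complex.exp_ne_zero _ h
    · have := sub_smul_dslope Complex.exp a s
      change (s - a) • e s = _ at this
      rw [h, smul_zero] at this
      exact hsa (exp_eq_ofReal_exp_strip hs (sub_eq_zero.mp this.symm))
  refine ⟨fun s => -dslope A a s / (x * e s), fun s hs => ?_, fun s hs h0 hsa => ?_⟩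
  · exact ((hAd'.differentiableAt (hU.mem_nhds (hqs s hs))).neg).div
      ((differentiableAt_const _).mul (he s)) (mul_ne_zero hxC (hes s hs))
  · have h1 := sub_smul_dslope Complex.exp a s
    have h2 := sub_smul_dslope A a s
    change (s - a) • e s = _ at h1
    rw [hAa, hAe s hs h0] at h2
    have h3 : 1 + (x : ℂ) - x * Complex.exp s = -(x * ((s - a) * e s)) := by
      rw [← smul_eq_mul (s - a : ℂ), h1, hea]
      field_simp
      ring
    rw [← h2, h3, smul_eq_mul]
    have := sub_ne_zero.mpr hsa
    have := hes s hs
    field_simp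

lemma tendsto_vertical_integral {B : ℂ → ℂ} {c : ℂ} {l : Filter ℝ}
    (hB : ∀ s : ℂ, |s.im| ≤ Real.pi → DifferentiableAt ℂ B s)
    (hl : Tendsto B (comap Complex.re l ⊓ 𝓟 {s | |s.im| ≤ Real.pi}) (𝓝 c)) :
    Tendsto (fun R : ℝ => ∫ y : ℝ in -Real.pi..Real.pi, B (R + y * Complex.I)) l
      (𝓝 (2 * Real.pi * c)) := by
  have hπ := Real.pi_pos
  rw [Metric.tendsto_nhds]
  intro ε hε
  have hev := hl (Metric.ball_mem_nhds c (show 0 < ε / (4 * Real.pi) by positivity))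
  rw [mem_map, mem_inf_principal, mem_comap] at hev
  obtain ⟨t, ht, hsub⟩ := hev
  filter_upwards [ht] with R hR
  have hmem : ∀ y ∈ Set.uIcc (-Real.pi) Real.pi, |y| ≤ Real.pi := by
    intro y hy
    rw [Set.uIcc_of_le (by linarith)] at hy
    exact abs_le.mpr hy
  have hint : IntervalIntegrable (fun y : ℝ => B (R + y * Complex.I)) volume
      (-Real.pi) Real.pi := by
    refine ContinuousOn.intervalIntegrable fun y hy => ?_
    have h1 : ContinuousAt B (R + y * Complex.I) :=
      (hB _ (by simpa using hmem y hy)).continuousAt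
    exact (ContinuousAt.comp (f := fun y : ℝ => (R : ℂ) + y * Complex.I) h1
      (by fun_prop)).continuousWithinAt
  have hc : 2 * Real.pi * c = ∫ _ in -Real.pi..Real.pi, c := by
    rw [intervalIntegral.integral_const, Complex.real_smul]
    push_cast
    ring
  rw [dist_eq_norm, hc, ← intervalIntegral.integral_sub hint (by simp)]
  refine (intervalIntegral.norm_integral_le_of_norm_le_const (C := ε / (4 * Real.pi))
    fun y hy => ?_).trans_lt ?_
  · have hy' := hmem y (Set.uIoc_subset_uIcc hy)
    have := @hsub (R + y * Complex.I) (by simpa using hR) (by simpa using hy')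
    rw [Set.mem_preimage, mem_ball_iff_norm] at this
    exact this.le
  · rw [show Real.pi - -Real.pi = 2 * Real.pi by ring, abs_of_pos (by positivity)]
    field_simp
    norm_num

lemma tendsto_stripFun_atTop {x : ℝ} (hx : 0 < x) (C : ℂ) :
    Tendsto (fun s : ℂ => ((Complex.exp s - 1) ^ 2 / ((s - 1) * Complex.exp s + 1) - C) /
      (1 + x - x * Complex.exp s)) (comap Complex.re atTop) (𝓝 0) := by
  have hxC : (x : ℂ) ≠ 0 := by exact_mod_cast hx.ne'
  have hE : Tendsto (fun s : ℂ => (Complex.exp s)⁻¹) (comap Complex.re atTop) (𝓝 0) :=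
    tendsto_inv₀_cobounded.comp Complex.tendsto_exp_comap_re_atTop
  have hden : Tendsto (fun s : ℂ => (s - 1 + (Complex.exp s)⁻¹)⁻¹) (comap Complex.re atTop)
      (𝓝 0) := by
    refine tendsto_inv₀_cobounded.comp ?_
    rw [← tendsto_norm_atTop_iff_cobounded]
    have h1 : Tendsto (fun s : ℂ => s.re + (-1 - ‖(Complex.exp s)⁻¹‖)) (comap Complex.re atTop)
        atTop := tendsto_comap.atTop_add (hE.norm.const_sub (-1))
    refine tendsto_atTop_mono (fun s => ?_) h1
    have h2 := Complex.re_le_norm (s - 1)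
    have h3 := norm_sub_norm_le (s - 1) (-(Complex.exp s)⁻¹)
    rw [norm_neg, sub_neg_eq_add] at h3
    simp only [Complex.sub_re, Complex.one_re] at h2
    linarith
  have hk : Tendsto (fun s : ℂ => ((1 + x) * (Complex.exp s)⁻¹ - x)⁻¹) (comap Complex.re atTop)
      (𝓝 (((1 + x) * 0 - x)⁻¹)) :=
    ((hE.const_mul _).sub_const _).inv₀ (by simpa using hxC)
  have hn : Tendsto (fun s : ℂ => (1 - (Complex.exp s)⁻¹) ^ 2) (comap Complex.re atTop)
      (𝓝 ((1 - 0) ^ 2)) := (hE.const_sub 1).pow 2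
  have hall := ((hn.mul hden).sub (hE.const_mul C)).mul hk
  simp only [mul_zero, sub_self, zero_mul] at hall
  refine hall.congr fun s => ?_
  have he := Complex.exp_ne_zero s
  have h1 : s - 1 + (Complex.exp s)⁻¹ = ((s - 1) * Complex.exp s + 1) / Complex.exp s := by
    field_simp
  have h2 : (1 + x) * (Complex.exp s)⁻¹ - x = (1 + x - x * Complex.exp s) / Complex.exp s := by
    field_simp
  rw [h1, h2, inv_div, inv_div, div_eq_mul_inv _ (_ + 1 : ℂ), div_eq_mul_inv _ (_ + 1 : ℂ)]
  field_simp

lemma tendsto_stripFun_atBot {x : ℝ} (hx : 0 < x) (C : ℂ) :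
    Tendsto (fun s : ℂ => ((Complex.exp s - 1) ^ 2 / ((s - 1) * Complex.exp s + 1) - C) /
      (1 + x - x * Complex.exp s)) (comap Complex.re atBot ⊓ 𝓟 {s | |s.im| ≤ Real.pi})
      (𝓝 ((1 - C) / (1 + x))) := by
  have hxC : (1 : ℂ) + x ≠ 0 := by exact_mod_cast (by positivity : 1 + x ≠ 0)
  set l := comap Complex.re atBot ⊓ 𝓟 {s : ℂ | |s.im| ≤ Real.pi}
  have hE : Tendsto Complex.exp l (𝓝 0) := Complex.tendsto_exp_comap_re_atBot.mono_left inf_le_left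
  have hre : Tendsto (fun s : ℂ => -s.re) l atTop :=
    tendsto_neg_atBot_atTop.comp (tendsto_comap.mono_left inf_le_left)
  have hsE : Tendsto (fun s : ℂ => s * Complex.exp s) l (𝓝 0) := by
    have h1 := (Real.tendsto_pow_mul_exp_neg_atTop_nhds_zero 1).comp hre
    have h0 := ((Real.tendsto_pow_mul_exp_neg_atTop_nhds_zero 0).comp hre).const_mul Real.pi
    have h := h1.add h0
    simp only [mul_zero, add_zero] at h
    refine squeeze_zero_norm' ?_ h
    have hpr : ∀ᶠ s : ℂ in l, |s.im| ≤ Real.pi := mem_inf_of_right (mem_principal_self _)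
    filter_upwards [hpr, hre.eventually_ge_atTop 0] with s hs hs0
    have hn := Complex.norm_le_abs_re_add_abs_im s
    rw [abs_of_nonpos (by linarith)] at hn
    simp only [Function.comp, pow_one, pow_zero, neg_neg, one_mul, norm_mul, Complex.norm_exp]
    rw [← add_mul]
    gcongr
    linarith
  have hden : Tendsto (fun s : ℂ => (s - 1) * Complex.exp s + 1) l (𝓝 (0 - 0 + 1)) :=
    ((hsE.sub hE).add_const 1).congr fun s => by ring
  have hall := ((((hE.sub_const 1).pow 2).div hden (by norm_num)).sub_const C).div
    ((hE.const_mul (x : ℂ)).const_sub ((1 : ℂ) + x)) (by simpa using hxC)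
  have hval : (1 - C) / (1 + x) = ((0 - 1) ^ 2 / (0 - 0 + 1) - C) / (1 + x - x * 0) := by ring
  exact hval ▸ hall

/-- The difference of the strip function between `u - πi` and `u + πi`, divided by `-2πi`. -/
noncomputable def jumpDensity (x u : ℝ) : ℝ :=
  Real.exp u * (1 + Real.exp u) ^ 2 /
    (((Real.exp u * u - 1 - Real.exp u) ^ 2 + Real.pi ^ 2 * Real.exp u ^ 2) *
      (1 + x + x * Real.exp u))

lemma jumpDensity_nonneg {x : ℝ} (hx : 0 < x) (u : ℝ) : 0 ≤ jumpDensity x u := by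
  unfold jumpDensity
  positivity

lemma continuous_jumpDensity {x : ℝ} (hx : 0 < x) : Continuous (jumpDensity x) := by
  unfold jumpDensity
  refine Continuous.div (by fun_prop) (by fun_prop) fun u => ?_
  have := Real.pi_pos
  positivity

lemma stripFun_sub_eq {x : ℝ} (hx : 0 < x) (C : ℂ) (u : ℝ) :
    ((Complex.exp (u + (-Real.pi : ℝ) * Complex.I) - 1) ^ 2 /
      ((u + (-Real.pi : ℝ) * Complex.I - 1) * Complex.exp (u + (-Real.pi : ℝ) * Complex.I) + 1) -
        C) /
      (1 + x - x * Complex.exp (u + (-Real.pi : ℝ) * Complex.I)) -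
    ((Complex.exp (u + Real.pi * Complex.I) - 1) ^ 2 /
      ((u + Real.pi * Complex.I - 1) * Complex.exp (u + Real.pi * Complex.I) + 1) - C) /
      (1 + x - x * Complex.exp (u + Real.pi * Complex.I)) =
    -(2 * Real.pi * Complex.I) * jumpDensity x u := by
  have h1 : Complex.exp (u + Real.pi * Complex.I) = -(Real.exp u : ℂ) := by
    rw [Complex.exp_add, Complex.exp_pi_mul_I, Complex.ofReal_exp]
    ring
  have h2 : Complex.exp (u + (-Real.pi : ℝ) * Complex.I) = -(Real.exp u : ℂ) := by
    rw [Complex.exp_add, Complex.ofReal_neg, neg_mul, Complex.exp_neg, Complex.exp_pi_mul_I,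
      Complex.ofReal_exp, inv_neg, inv_one]
    ring
  rw [h1, h2]
  unfold jumpDensity
  have hE : 0 < Real.exp u := Real.exp_pos u
  set E := Real.exp u
  have hπ := Real.pi_pos
  have hk : (1 : ℂ) + x + x * E ≠ 0 := by exact_mod_cast (by positivity : 1 + x + x * E ≠ 0)
  have him : ∀ r : ℝ, r ≠ 0 → ((u : ℂ) + r * Complex.I - 1) * -(E : ℂ) + 1 ≠ 0 := by
    intro r hr h
    have := congrArg Complex.im h
    simp [hr, hE.ne'] at this
  have hp := him Real.pi hπ.ne'
  have hm := him (-Real.pi) (neg_ne_zero.mpr hπ.ne')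
  have hprod : (((E : ℂ) * u - 1 - E) ^ 2 + Real.pi ^ 2 * E ^ 2) =
      ((u + (-Real.pi : ℝ) * Complex.I - 1) * -(E : ℂ) + 1) *
        ((u + Real.pi * Complex.I - 1) * -(E : ℂ) + 1) := by
    push_cast
    linear_combination ((Real.pi : ℂ) ^ 2 * E ^ 2) * Complex.I_sq
  have hsub : ((u + Real.pi * Complex.I - 1) * -(E : ℂ) + 1) -
      ((u + (-Real.pi : ℝ) * Complex.I - 1) * -(E : ℂ) + 1) = -(2 * Real.pi * Complex.I) * E := by
    push_cast
    ring
  push_cast at hprod ⊢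
  push_cast at hm hsub
  rw [hprod, mul_neg (x : ℂ), sub_neg_eq_add]
  generalize ((u : ℂ) + Real.pi * Complex.I - 1) * -(E : ℂ) + 1 = P at *
  generalize ((u : ℂ) + -Real.pi * Complex.I - 1) * -(E : ℂ) + 1 = M at *
  generalize (1 : ℂ) + x + x * E = k at *
  field_simp
  linear_combination (1 + (E : ℂ)) ^ 2 * hsub

lemma integral_jumpDensity {x : ℝ} (hx : 0 < x) :
    ∫ u, jumpDensity x u =
      (1 / (x * ((x + 1) * Real.log (1 + 1 / x) - 1)) - 1) / (1 + x) := by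
  have hπ := Real.pi_pos
  obtain ⟨B, hB, hBe⟩ := exists_strip_extension hx
  set a : ℝ := Real.log (1 + 1 / x) with ha
  set C : ℝ := 1 / (x * ((x + 1) * a - 1))
  have ha0 : 0 < a := Real.log_pos (by
    have : 0 < 1 / x := by positivity
    linarith)
  have hpr : ∀ k : Filter ℂ, ∀ᶠ s : ℂ in k ⊓ 𝓟 {s : ℂ | |s.im| ≤ Real.pi}, |s.im| ≤ Real.pi :=
    fun k => mem_inf_of_right (mem_principal_self _)
  have htop : Tendsto B (comap Complex.re atTop ⊓ 𝓟 {s | |s.im| ≤ Real.pi}) (𝓝 0) := by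
    refine ((tendsto_stripFun_atTop hx C).mono_left inf_le_left).congr' ?_
    have hre : ∀ᶠ s : ℂ in comap Complex.re atTop ⊓ 𝓟 {s : ℂ | |s.im| ≤ Real.pi}, a < s.re :=
      (tendsto_comap.mono_left inf_le_left).eventually_gt_atTop a
    filter_upwards [hpr _, hre] with s hs hsr
    refine (hBe s hs ?_ ?_).symm
    · rintro rfl
      simp at hsr
      linarith
    · rintro rfl
      simp at hsr
  have hbot : Tendsto B (comap Complex.re atBot ⊓ 𝓟 {s | |s.im| ≤ Real.pi})
      (𝓝 ((1 - C) / (1 + x))) := by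
    refine (tendsto_stripFun_atBot hx C).congr' ?_
    have hre : ∀ᶠ s : ℂ in comap Complex.re atBot ⊓ 𝓟 {s : ℂ | |s.im| ≤ Real.pi}, s.re < 0 :=
      (tendsto_comap.mono_left inf_le_left).eventually_lt_atBot 0
    filter_upwards [hpr _, hre] with s hs hsr
    refine (hBe s hs ?_ ?_).symm
    · rintro rfl
      simp at hsr
    · rintro rfl
      simp at hsr
      linarith
  have hvtop := tendsto_vertical_integral hB htop
  have hvbot := (tendsto_vertical_integral hB hbot).comp tendsto_neg_atTop_atBot
  have hcont : ∀ v : ℝ, |v| ≤ Real.pi → Continuous fun u : ℝ => B (u + v * Complex.I) := by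
    intro v hv
    refine continuous_iff_continuousAt.mpr fun u => ?_
    have h1 : ContinuousAt B (u + v * Complex.I) := (hB _ (by simpa using hv)).continuousAt
    exact ContinuousAt.comp (f := fun u : ℝ => (u : ℂ) + v * Complex.I) h1 (by fun_prop)
  have hjump : ∀ u : ℝ, B (u + (-Real.pi : ℝ) * Complex.I) - B (u + Real.pi * Complex.I) =
      -(2 * Real.pi * Complex.I) * jumpDensity x u := by
    intro u
    have hne : ∀ v r : ℝ, v ≠ 0 → (u : ℂ) + v * Complex.I ≠ (r : ℝ) := by
      intro v r hv h
      have := congrArg Complex.im h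
      simp [hv] at this
    rw [← stripFun_sub_eq hx C u, hBe _ (by simp [abs_of_pos hπ]) _ (hne _ a (by simp [hπ.ne'])),
      hBe _ (by simp [abs_of_pos hπ]) _ (hne _ a hπ.ne')]
    · simpa only [Complex.ofReal_zero] using hne Real.pi 0 hπ.ne'
    · simpa only [Complex.ofReal_zero] using hne (-Real.pi) 0 (neg_ne_zero.mpr hπ.ne')
  have hrect : ∀ R : ℝ, ((∫ u in -R..R, jumpDensity x u : ℝ) : ℂ) =
      ((∫ y : ℝ in -Real.pi..Real.pi, B (R + y * Complex.I)) -
        ∫ y : ℝ in -Real.pi..Real.pi, B ((-R : ℝ) + y * Complex.I)) / (2 * Real.pi) := by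
    intro R
    have h := Complex.integral_boundary_rect_eq_zero_of_differentiableOn B
      ⟨-R, -Real.pi⟩ ⟨R, Real.pi⟩ fun s hs => by
        have h2 : s.im ∈ Set.uIcc (-Real.pi) Real.pi := hs.2
        rw [Set.uIcc_of_le (by linarith)] at h2
        exact (hB s (abs_le.mpr h2)).differentiableWithinAt
    simp only at h
    rw [← intervalIntegral.integral_sub
      ((hcont (-Real.pi) (by simp [abs_of_pos hπ])).intervalIntegrable _ _)
      ((hcont Real.pi (by simp [abs_of_pos hπ])).intervalIntegrable _ _),
      intervalIntegral.integral_congr (fun u _ => hjump u), intervalIntegral.integral_const_mul,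
      intervalIntegral.integral_ofReal] at h
    have hπC : (Real.pi : ℂ) ≠ 0 := by exact_mod_cast hπ.ne'
    rw [eq_div_iff (mul_ne_zero two_ne_zero hπC)]
    apply mul_left_cancel₀ Complex.I_ne_zero
    simp only [smul_eq_mul] at h
    linear_combination -h
  have hlimC : Tendsto (fun R : ℝ => ((∫ u in -R..R, jumpDensity x u : ℝ) : ℂ)) atTop
      (𝓝 (((C - 1) / (1 + x) : ℝ) : ℂ)) := by
    have hπC : (Real.pi : ℂ) ≠ 0 := by exact_mod_cast hπ.ne'
    have hxC : (1 : ℂ) + x ≠ 0 := by exact_mod_cast (by positivity : 1 + x ≠ 0)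
    have h := (hvtop.sub hvbot).div_const (2 * (Real.pi : ℂ))
    refine (h.congr fun R => ?_).trans (le_of_eq ?_)
    · rw [hrect R]
      rfl
    · congr 1
      push_cast
      field_simp
      ring
  have hlim : Tendsto (fun R : ℝ => ∫ u in -R..R, jumpDensity x u) atTop
      (𝓝 ((C - 1) / (1 + x))) := by
    have := (Complex.continuous_re.tendsto _).comp hlimC
    simpa only [Complex.ofReal_re, Function.comp_def] using this
  have hint : Integrable (jumpDensity x) := by
    refine integrable_of_intervalIntegral_norm_tendsto (l := atTop) (a := fun R => -R)
      (b := fun R => R) ((C - 1) / (1 + x)) (fun R => (continuous_jumpDensity hx).integrableOn_Ioc)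
      tendsto_neg_atTop_atBot tendsto_id ?_
    simpa only [Real.norm_of_nonneg (jumpDensity_nonneg hx _)] using hlim
  exact tendsto_nhds_unique
    (intervalIntegral_tendsto_integral hint tendsto_neg_atTop_atBot tendsto_id) hlim

lemma integral_tau0_div {x : ℝ} (hx : 0 < x) :
    ∫ t in (0 : ℝ)..1, tau0 t / (x + t) = ∫ u, jumpDensity x u := by
  have himg : (fun u => (1 + Real.exp u)⁻¹) '' Set.univ = Set.Ioo (0 : ℝ) 1 := by
    ext t
    simp only [Set.image_univ, Set.mem_range, Set.mem_Ioo]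
    constructor
    · rintro ⟨u, rfl⟩
      have := Real.exp_pos u
      exact ⟨by positivity, inv_lt_one_of_one_lt₀ (by linarith)⟩
    · rintro ⟨h0, h1⟩
      refine ⟨Real.log ((1 - t) / t), ?_⟩
      rw [Real.exp_log (div_pos (by linarith) h0)]
      field_simp
      ring
  have hd : ∀ u ∈ Set.univ, HasDerivWithinAt (fun u => (1 + Real.exp u)⁻¹)
      (-Real.exp u / (1 + Real.exp u) ^ 2) Set.univ u := fun u _ =>
    (((Real.hasDerivAt_exp u).const_add 1).inv (by positivity)).hasDerivWithinAt
  have hinj : Set.InjOn (fun u => (1 + Real.exp u)⁻¹) Set.univ := by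
    intro u _ v _ h
    exact Real.exp_injective (add_left_cancel (inv_injective h))
  rw [intervalIntegral.integral_of_le zero_le_one, integral_Ioc_eq_integral_Ioo, ← himg,
    integral_image_eq_integral_abs_deriv_smul MeasurableSet.univ hd hinj, setIntegral_univ]
  congr 1 with u
  have hE := Real.exp_pos u
  have h1 : (1 - (1 + Real.exp u)⁻¹) / (1 + Real.exp u)⁻¹ = Real.exp u := by
    field_simp
    ring
  unfold tau0 jumpDensity
  rw [h1, Real.log_exp, neg_div, abs_neg, abs_of_pos (by positivity), smul_eq_mul]
  set E := Real.exp u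
  have hπ := Real.pi_pos
  have h2 : (1 + E)⁻¹ * ((1 - (1 + E)⁻¹) * u - 1) ^ 2 + Real.pi ^ 2 * (1 + E)⁻¹ *
      (1 - (1 + E)⁻¹) ^ 2 = ((E * u - 1 - E) ^ 2 + Real.pi ^ 2 * E ^ 2) / (1 + E) ^ 3 := by
    field_simp
    ring
  have h3 : x + (1 + E)⁻¹ = (1 + x + x * E) / (1 + E) := by
    field_simp
    ring
  rw [h2, h3]
  have h4 : 0 < (E * u - 1 - E) ^ 2 + Real.pi ^ 2 * E ^ 2 := by positivity
  field_simp

lemma gfun_eq {x : ℝ} (hx : 0 < x) :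
    gfun x = 1 / (x * (x + 1) * ((x + 1) * Real.log (1 + 1 / x) - 1)) := by
  have hpos : 0 < 1 + 1 / x := by positivity
  have hd : HasDerivAt rho (-(1 / (x * (x + 1) ^ 2))) x := by
    have h1 : HasDerivAt (fun y : ℝ => 1 + 1 / y) (-(x ^ 2)⁻¹) x := by
      simpa only [one_div] using (hasDerivAt_inv hx.ne').const_add 1
    have h2 : HasDerivAt (fun y : ℝ => 1 / (y + 1)) (-1 / (x + 1) ^ 2) x := by
      simp only [one_div]
      exact ((hasDerivAt_id x).add_const 1).inv (add_pos hx one_pos).ne'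
    refine ((h1.log hpos.ne').sub h2).congr_deriv ?_
    field_simp
    ring
  have hrho : rho x = ((x + 1) * Real.log (1 + 1 / x) - 1) / (x + 1) := by
    unfold rho
    field_simp
  rw [gfun, hd.deriv, hrho, neg_neg, div_div_eq_mul_div, ← div_div 1 (x * (x + 1))]
  congr 1
  field_simp

/-- For every `x > 0`, `g(x) = 1/( x(x+1)[(x+1)log(1+1/x) − 1] )` and `g` admits the
Stieltjes representation `g(x) = 1/(x+1) + ∫₀¹ τ₀(t)/(x+t) dt`. -/
theorem gfun_formula_and_stieltjes (x : ℝ) (hx : 0 < x) :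
    gfun x = 1 / (x * (x + 1) * ((x + 1) * Real.log (1 + 1 / x) - 1)) ∧
    gfun x = 1 / (x + 1) + ∫ t in (0 : ℝ)..1, tau0 t / (x + t) := by
  refine ⟨gfun_eq hx, ?_⟩
  rw [gfun_eq hx, integral_tau0_div hx, integral_jumpDensity hx, add_comm 1 x, ← add_div,
    add_sub_cancel, div_div]
  congr 1
  ring
end

section
/- There exists a real number β* with 2.188585 ≤ β* < 2.18859 such that for every α > 0 the following holds: the function x ↦ −h_α″(x)/h_α′(x) is completely monotonic on (0,∞) if and only if α ≤ β*, where h_α(x) = exp(αx·log(1 + 1/x)). -/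
/-- A function `u : ℝ → ℝ` is completely monotonic on `(0,∞)` if it is infinitely
differentiable there and `(-1)^n u^{(n)}(x) ≥ 0` for all `x > 0` and all `n ≥ 0`. -/
def CompletelyMonotonicOn (u : ℝ → ℝ) : Prop :=
  ContDiffOn ℝ (⊤ : ℕ∞) u (Set.Ioi 0) ∧
  ∀ (n : ℕ), ∀ x ∈ Set.Ioi (0 : ℝ), 0 ≤ (-1 : ℝ) ^ n * iteratedDerivWithin n u (Set.Ioi 0) x

/-- `h_α(x) = exp(αx·log(1 + 1/x))`. -/
noncomputable def hfun (α : ℝ) (x : ℝ) : ℝ := Real.exp (α * x * Real.log (1 + 1 / x))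

open scoped Nat Topology
open Filter Set

/-! ### Series in powers of `1 / (x + 1)` -/

/-- The series `∑ aₙ (n+m)!/n! (x+1)^{-(n+m+1)}`, which is `(-1)^m` times the `m`-th derivative of
`∑ aₙ (x+1)^{-(n+1)}` and the Laplace transform of `t ↦ t^m e^{-t} ∑ aₙ tⁿ/n!`. -/
noncomputable def invPowSeries (a : ℕ → ℝ) (m : ℕ) (x : ℝ) : ℝ :=
  ∑' n, a n * (((n + m)! : ℝ) / (n ! : ℝ) * ((x + 1) ^ (n + m + 1))⁻¹)

/-- The exponential generating function of `a`. -/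
noncomputable def expGenFun (a : ℕ → ℝ) (t : ℝ) : ℝ := ∑' n, a n * (t ^ n / (n ! : ℝ))

theorem factorial_add_div_eq (n m : ℕ) :
    ((n + m)! : ℝ) / (n ! : ℝ) = (m ! : ℝ) * ((n + m).choose m : ℝ) := by
  have h := Nat.add_choose_mul_factorial_mul_factorial n m
  rw [← h]
  have := Nat.factorial_ne_zero n
  push_cast
  field_simp

theorem summable_factorial_div_mul_inv_pow (m : ℕ) {x : ℝ} (hx : 0 < x) :
    Summable fun n : ℕ => ((n + m)! : ℝ) / (n ! : ℝ) * ((x + 1) ^ (n + m + 1))⁻¹ := by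
  have hr : ‖(x + 1)⁻¹‖ < 1 := by
    rw [Real.norm_of_nonneg (by positivity)]
    exact inv_lt_one_of_one_lt₀ (by linarith)
  refine ((summable_choose_mul_geometric_of_norm_lt_one m hr).mul_left
    ((m ! : ℝ) * ((x + 1)⁻¹) ^ (m + 1))).congr fun n => ?_
  rw [factorial_add_div_eq, ← inv_pow]
  ring

theorem summable_invPowSeries {a : ℕ → ℝ} {C : ℝ} (ha : ∀ n, |a n| ≤ C) (m : ℕ) {x : ℝ}
    (hx : 0 < x) :
    Summable fun n => a n * (((n + m)! : ℝ) / (n ! : ℝ) * ((x + 1) ^ (n + m + 1))⁻¹) := by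
  refine Summable.of_norm_bounded ((summable_factorial_div_mul_inv_pow m hx).mul_left C)
    fun n => ?_
  have hnn : 0 ≤ ((n + m)! : ℝ) / (n ! : ℝ) * ((x + 1) ^ (n + m + 1))⁻¹ := by positivity
  rw [norm_mul, Real.norm_eq_abs, Real.norm_of_nonneg hnn]
  exact mul_le_mul_of_nonneg_right (ha n) hnn

theorem hasDerivAt_invPowSeries {a : ℕ → ℝ} {C : ℝ} (ha : ∀ n, |a n| ≤ C) (m : ℕ) {x : ℝ}
    (hx : 0 < x) : HasDerivAt (invPowSeries a m) (-invPowSeries a (m + 1) x) x := by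
  have hx2 : 0 < x / 2 := by positivity
  have key := hasDerivAt_tsum_of_isPreconnected (t := Ioi (x / 2)) (y₀ := x) (y := x)
    (g := fun n y => a n * (((n + m)! : ℝ) / (n ! : ℝ) * ((y + 1) ^ (n + m + 1))⁻¹))
    (g' := fun n y => -(a n * (((n + (m + 1))! : ℝ) / (n ! : ℝ) *
      ((y + 1) ^ (n + (m + 1) + 1))⁻¹)))
    ((summable_factorial_div_mul_inv_pow (m + 1) hx2).mul_left C) isOpen_Ioi isPreconnected_Ioi
    (fun n y hy => ?_) (fun n y hy => ?_) (by simp [hx]) (summable_invPowSeries ha m hx)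
    (by simp [hx])
  · rw [tsum_neg] at key
    exact key
  · have hy0 : 0 < y + 1 := by have := hx2.trans hy; linarith
    have h1 : HasDerivAt (fun y : ℝ => (y + 1) ^ (n + m + 1))
        (((n + m + 1 : ℕ) : ℝ) * (y + 1) ^ (n + m) * 1) y := by
      exact ((hasDerivAt_id y).add_const (1 : ℝ)).fun_pow (n + m + 1)
    have h2 := ((h1.inv (by positivity)).const_mul (((n + m)! : ℝ) / (n ! : ℝ))).const_mul (a n)
    refine h2.congr_deriv ?_
    rw [show n + (m + 1) = n + m + 1 by ring, Nat.factorial_succ]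
    have := Nat.factorial_ne_zero n
    push_cast
    field_simp
    ring
  · have hy0 : 0 < y := hx2.trans hy
    have hnn : 0 ≤ ((n + (m + 1))! : ℝ) / (n ! : ℝ) * ((y + 1) ^ (n + (m + 1) + 1))⁻¹ := by
      positivity
    rw [norm_neg, norm_mul, Real.norm_eq_abs, Real.norm_of_nonneg hnn]
    have hC : 0 ≤ C := (abs_nonneg _).trans (ha 0)
    have hy' : x / 2 ≤ y := le_of_lt hy
    refine mul_le_mul (ha n) ?_ hnn hC
    gcongr

theorem iteratedDerivWithin_invPowSeries {a : ℕ → ℝ} {C : ℝ} (ha : ∀ n, |a n| ≤ C) (m : ℕ) :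
    ∀ x ∈ Ioi (0 : ℝ), iteratedDerivWithin m (invPowSeries a 0) (Ioi 0) x =
      (-1) ^ m * invPowSeries a m x := by
  induction m with
  | zero => simp
  | succ m ih =>
    intro x hx
    rw [iteratedDerivWithin_succ, derivWithin_congr ih (ih x hx),
      derivWithin_of_isOpen isOpen_Ioi hx,
      ((hasDerivAt_invPowSeries ha m hx).const_mul ((-1 : ℝ) ^ m)).deriv]
    ring

theorem completelyMonotonicOn_invPowSeries_iff {a : ℕ → ℝ} {C : ℝ} (ha : ∀ n, |a n| ≤ C) :
    CompletelyMonotonicOn (invPowSeries a 0) ↔ ∀ m, ∀ x > 0, 0 ≤ invPowSeries a m x := by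
  have hpow (m : ℕ) : (-1 : ℝ) ^ m * (-1) ^ m = 1 := by rw [← mul_pow]; simp
  constructor
  · intro h m x hx
    have := h.2 m x hx
    rwa [iteratedDerivWithin_invPowSeries ha m x hx, ← mul_assoc, hpow, one_mul] at this
  · intro h
    refine ⟨contDiffOn_of_differentiableOn_deriv fun m _ => ?_, fun m x hx => ?_⟩
    · refine DifferentiableOn.congr (f := fun x => (-1) ^ m * invPowSeries a m x) ?_
        (iteratedDerivWithin_invPowSeries ha m)
      exact fun x hx =>
        ((hasDerivAt_invPowSeries ha m hx).const_mul _).differentiableAt.differentiableWithinAt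
    · rw [iteratedDerivWithin_invPowSeries ha m x hx, ← mul_assoc, hpow, one_mul]
      exact h m x hx

theorem completelyMonotonicOn_congr {u v : ℝ → ℝ} (h : EqOn u v (Ioi 0)) :
    CompletelyMonotonicOn u ↔ CompletelyMonotonicOn v := by
  unfold CompletelyMonotonicOn
  refine and_congr (contDiffOn_congr h) (forall_congr' fun n => forall₂_congr fun x hx => ?_)
  rw [iteratedDerivWithin_congr h hx]

theorem integral_pow_mul_exp_neg_mul (k : ℕ) {r : ℝ} (hr : 0 < r) :
    ∫ t in Ioi (0 : ℝ), t ^ k * Real.exp (-(r * t)) = (k ! : ℝ) * (r ^ (k + 1))⁻¹ := by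
  have h := Real.integral_rpow_mul_exp_neg_mul_Ioi (a := (k : ℝ) + 1) (by positivity) hr
  rw [Real.Gamma_nat_eq_factorial] at h
  simp only [add_sub_cancel_right, Real.rpow_natCast] at h
  rw [h, ← Nat.cast_succ, Real.rpow_natCast, one_div, inv_pow, mul_comm]

theorem summable_expGenFun {a : ℕ → ℝ} {C : ℝ} (ha : ∀ n, |a n| ≤ C) (t : ℝ) :
    Summable fun n => a n * (t ^ n / (n ! : ℝ)) := by
  refine Summable.of_norm_bounded ((Real.summable_pow_div_factorial |t|).mul_left C) fun n => ?_
  rw [norm_mul, Real.norm_eq_abs, norm_div, norm_pow, Real.norm_eq_abs, Real.norm_natCast]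
  exact mul_le_mul_of_nonneg_right (ha n) (by positivity)

theorem invPowSeries_eq_integral {a : ℕ → ℝ} {C : ℝ} (ha : ∀ n, |a n| ≤ C) (m : ℕ) {x : ℝ}
    (hx : 0 < x) :
    invPowSeries a m x =
      ∫ t in Ioi (0 : ℝ), t ^ m * Real.exp (-((x + 1) * t)) * expGenFun a t := by
  have hx1 : 0 < x + 1 := by linarith
  set F : ℕ → ℝ → ℝ := fun n t => a n / (n ! : ℝ) * (t ^ (n + m) * Real.exp (-((x + 1) * t)))
  have hint (n : ℕ) : MeasureTheory.IntegrableOn (F n) (Ioi 0) := by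
    refine (MeasureTheory.Integrable.of_integral_ne_zero ?_).const_mul _
    rw [integral_pow_mul_exp_neg_mul _ hx1]
    positivity
  have hF (n : ℕ) : ∫ t in Ioi (0 : ℝ), F n t =
      a n * (((n + m)! : ℝ) / (n ! : ℝ) * ((x + 1) ^ (n + m + 1))⁻¹) := by
    simp only [F]
    rw [MeasureTheory.integral_const_mul, integral_pow_mul_exp_neg_mul _ hx1]
    ring
  have hnorm (n : ℕ) : ∫ t in Ioi (0 : ℝ), ‖F n t‖ =
      |a n| * (((n + m)! : ℝ) / (n ! : ℝ) * ((x + 1) ^ (n + m + 1))⁻¹) := by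
    have : ∀ t ∈ Ioi (0 : ℝ),
        ‖F n t‖ = |a n| / (n ! : ℝ) * (t ^ (n + m) * Real.exp (-((x + 1) * t))) := by
      intro t ht
      have ht' : 0 < t := ht
      simp only [F]
      rw [norm_mul, norm_div, Real.norm_natCast, Real.norm_eq_abs,
        Real.norm_of_nonneg (by positivity : 0 ≤ t ^ (n + m) * Real.exp (-((x + 1) * t)))]
    rw [MeasureTheory.setIntegral_congr_fun measurableSet_Ioi this,
      MeasureTheory.integral_const_mul, integral_pow_mul_exp_neg_mul _ hx1]
    ring
  have hsum : Summable fun n => ∫ t in Ioi (0 : ℝ), ‖F n t‖ := by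
    simp only [hnorm]
    exact summable_invPowSeries (a := fun n => |a n|) (C := C) (by simpa using ha) m hx
  have key := (MeasureTheory.hasSum_integral_of_summable_integral_norm hint hsum).tsum_eq
  simp only [hF] at key
  rw [invPowSeries, key]
  congr 1
  ext t
  rw [expGenFun, ← tsum_mul_left]
  congr 1
  ext n
  simp only [F]
  ring

theorem invPowSeries_nonneg {a : ℕ → ℝ} {C : ℝ} (ha : ∀ n, |a n| ≤ C)
    (h : ∀ t > 0, 0 ≤ expGenFun a t) (m : ℕ) {x : ℝ} (hx : 0 < x) : 0 ≤ invPowSeries a m x := by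
  rw [invPowSeries_eq_integral ha m hx]
  refine MeasureTheory.setIntegral_nonneg measurableSet_Ioi fun t ht => ?_
  have ht' : 0 < t := ht
  exact mul_nonneg (by positivity) (h t ht)

theorem tendsto_choose_mul_div_pow (t : ℝ) (n : ℕ) :
    Tendsto (fun m : ℕ => ((n + m).choose m : ℝ) * (t / m) ^ n) atTop
      (𝓝 (t ^ n / (n ! : ℝ))) := by
  induction n with
  | zero => simp
  | succ n ih =>
    have h1 : Tendsto (fun m : ℕ => (t / (n + 1)) * (((n : ℝ) + 1) * (m : ℝ)⁻¹ + 1)) atTop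
        (𝓝 ((t / (n + 1)) * (((n : ℝ) + 1) * 0 + 1))) :=
      ((tendsto_inv_atTop_nhds_zero_nat.const_mul _).add_const 1).const_mul _
    have h2 := ih.mul h1
    have e : t ^ n / (n ! : ℝ) * ((t / (n + 1)) * (((n : ℝ) + 1) * 0 + 1)) =
        t ^ (n + 1) / ((n + 1)! : ℝ) := by
      rw [Nat.factorial_succ]
      have := Nat.factorial_ne_zero n
      push_cast
      field_simp
      ring
    rw [e] at h2
    refine h2.congr' ?_
    filter_upwards [eventually_gt_atTop 0] with m hm
    have hc : ((n + 1 + m).choose m : ℝ) * ((n : ℝ) + 1) =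
        ((n + m).choose m : ℝ) * ((n : ℝ) + 1 + m) := by
      have h := factorial_add_div_eq (n + 1) m
      have h' := factorial_add_div_eq n m
      rw [show n + 1 + m = n + m + 1 by ring, Nat.factorial_succ, Nat.factorial_succ n] at h
      have h0 : (n ! : ℝ) ≠ 0 := by exact_mod_cast Nat.factorial_ne_zero n
      have hm0 : (m ! : ℝ) ≠ 0 := by exact_mod_cast Nat.factorial_ne_zero m
      rw [show n + 1 + m = n + m + 1 by ring]
      push_cast at h
      rw [div_eq_iff (by positivity)] at h h'
      rw [h'] at h
      have : (m ! : ℝ) * (n ! : ℝ) ≠ 0 := mul_ne_zero hm0 h0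
      apply mul_left_cancel₀ this
      linear_combination -h
    have hm' : (m : ℝ) ≠ 0 := by exact_mod_cast hm.ne'
    have hn : (n : ℝ) + 1 ≠ 0 := by positivity
    rw [← mul_left_inj' hn, pow_succ,
      show ((n + 1 + m).choose m : ℝ) * ((t / m) ^ n * (t / m)) * ((n : ℝ) + 1) =
        ((n + 1 + m).choose m : ℝ) * ((n : ℝ) + 1) * ((t / m) ^ n * (t / m)) by ring, hc]
    field_simp

theorem expGenFun_nonneg {a : ℕ → ℝ} {C : ℝ} (ha : ∀ n, |a n| ≤ C)
    (h : ∀ m, ∀ x > 0, 0 ≤ invPowSeries a m x) {t : ℝ} (ht : 0 < t) : 0 ≤ expGenFun a t := by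
  have hC : 0 ≤ C := (abs_nonneg _).trans (ha 0)
  have hlim : Tendsto (fun m : ℕ => ∑' n, a n * (((n + m).choose m : ℝ) * (t / m) ^ n)) atTop
      (𝓝 (expGenFun a t)) := by
    refine tendsto_tsum_of_dominated_convergence
      (bound := fun n => C * (Real.exp (8 * t) * (1 / 2) ^ n))
      ((summable_geometric_two.mul_left _).mul_left _)
      (fun n => (tendsto_choose_mul_div_pow t n).const_mul (a n)) ?_
    filter_upwards [eventually_ge_atTop (max 1 ⌈4 * t⌉₊)] with m hm n
    have hm1 : (1 : ℝ) ≤ m := by exact_mod_cast (le_max_left _ _).trans hm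
    have hm2 : 4 * t ≤ m := (Nat.le_ceil _).trans (by exact_mod_cast (le_max_right _ _).trans hm)
    have hm0 : (0 : ℝ) < m := by linarith
    have hnn : 0 ≤ ((n + m).choose m : ℝ) * (t / m) ^ n := by positivity
    rw [norm_mul, Real.norm_eq_abs, Real.norm_of_nonneg hnn]
    refine mul_le_mul (ha n) ?_ hnn hC
    set y : ℝ := 2 * (t / m) with hy
    have hy0 : 0 ≤ y := by positivity
    have hy1 : y ≤ 1 / 2 := by
      rw [hy, ← mul_div_assoc, div_le_iff₀ hm0]
      linarith
    have hyn : ‖y‖ < 1 := by rw [Real.norm_of_nonneg hy0]; linarith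
    have hle : ((n + m).choose m : ℝ) * y ^ n ≤ 1 / (1 - y) ^ (m + 1) := by
      rw [← tsum_choose_mul_geometric_of_norm_lt_one m hyn]
      exact (summable_choose_mul_geometric_of_norm_lt_one m hyn).le_tsum n
        fun j _ => by positivity
    have hexp : 1 / (1 - y) ^ (m + 1) ≤ Real.exp (8 * t) := by
      have h1 : 1 / (1 - y) ≤ Real.exp (2 * y) := by
        refine le_trans ?_ (Real.add_one_le_exp _)
        rw [div_le_iff₀ (by linarith)]
        nlinarith
      rw [← one_div_pow]
      calc (1 / (1 - y)) ^ (m + 1) ≤ Real.exp (2 * y) ^ (m + 1) :=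
            pow_le_pow_left₀ (one_div_nonneg.2 (by linarith)) h1 _
        _ = Real.exp (((m + 1 : ℕ) : ℝ) * (2 * y)) := (Real.exp_nat_mul _ _).symm
        _ ≤ Real.exp (8 * t) := by
            apply Real.exp_le_exp.2
            have : y * m = 2 * t := by rw [hy]; field_simp
            push_cast
            nlinarith
    have e : ((n + m).choose m : ℝ) * (t / m) ^ n =
        ((n + m).choose m : ℝ) * y ^ n * (1 / 2) ^ n := by
      rw [mul_assoc, ← mul_pow, hy]
      congr 2
      ring
    rw [e]
    exact mul_le_mul_of_nonneg_right (hle.trans hexp) (by positivity)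
  refine ge_of_tendsto hlim ?_
  filter_upwards [eventually_gt_atTop ⌈t⌉₊] with m hm
  have hm' : t < m := (Nat.le_ceil t).trans_lt (by exact_mod_cast hm)
  have hx : 0 < (m : ℝ) / t - 1 := by
    rw [sub_pos, lt_div_iff₀ ht]
    linarith
  have hpos : 0 < (m ! : ℝ) * (t / m) ^ (m + 1) := by
    have : (0 : ℝ) < m := ht.trans hm'
    positivity
  have e : invPowSeries a m ((m : ℝ) / t - 1) =
      (m ! : ℝ) * (t / m) ^ (m + 1) * ∑' n, a n * (((n + m).choose m : ℝ) * (t / m) ^ n) := by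
    rw [invPowSeries, ← tsum_mul_left]
    congr 1
    ext n
    rw [factorial_add_div_eq, sub_add_cancel, ← inv_pow, inv_div]
    ring
  exact nonneg_of_mul_nonneg_right (e ▸ h m _ hx) hpos

theorem completelyMonotonicOn_invPowSeries_iff_expGenFun_nonneg {a : ℕ → ℝ} {C : ℝ}
    (ha : ∀ n, |a n| ≤ C) :
    CompletelyMonotonicOn (invPowSeries a 0) ↔ ∀ t > 0, 0 ≤ expGenFun a t :=
  (completelyMonotonicOn_invPowSeries_iff ha).trans
    ⟨fun h _ ht => expGenFun_nonneg ha h ht, fun h m _ hx => invPowSeries_nonneg ha h m hx⟩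

/-! ### The coefficients of `-g″/g′` and `g′`, where `g x = x log (1 + 1/x)` -/

/-- The coefficients of `-g″/g′` in powers of `1 / (x + 1)`; they satisfy a renewal equation. -/
noncomputable def renewalCoeff : ℕ → ℝ
  | 0 => 2
  | n + 1 => ∑ k : Fin (n + 1), 2 / (((k : ℕ) + 2 : ℝ) * ((k : ℕ) + 3)) * renewalCoeff (n - k)
decreasing_by omega

/-- The coefficients of `g′` in powers of `1 / (x + 1)`. -/
noncomputable def logCoeff : ℕ → ℝ
  | 0 => 0
  | n + 1 => 1 / ((n : ℝ) + 2)

theorem renewalCoeff_zero : renewalCoeff 0 = 2 := by rw [renewalCoeff]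

theorem renewalCoeff_succ (n : ℕ) : renewalCoeff (n + 1) =
    ∑ k ∈ Finset.range (n + 1), 2 / (((k : ℝ) + 2) * (k + 3)) * renewalCoeff (n - k) := by
  rw [renewalCoeff, Fin.sum_univ_eq_sum_range
    (fun k : ℕ => 2 / (((k : ℝ) + 2) * (k + 3)) * renewalCoeff (n - k))]

theorem sum_renewal_weights (N : ℕ) :
    ∑ k ∈ Finset.range N, 2 / (((k : ℝ) + 2) * (k + 3)) = 1 - 2 / (N + 2) := by
  induction N with
  | zero => simp
  | succ N ih =>
    rw [Finset.sum_range_succ, ih]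
    push_cast
    field_simp
    ring

theorem renewalCoeff_mem_Icc (n : ℕ) : 0 ≤ renewalCoeff n ∧ renewalCoeff n ≤ 2 := by
  induction n using Nat.strong_induction_on with
  | _ n ih =>
    cases n with
    | zero => rw [renewalCoeff_zero]; norm_num
    | succ n =>
      rw [renewalCoeff_succ]
      refine ⟨Finset.sum_nonneg fun k _ => mul_nonneg (by positivity) (ih _ (by omega)).1, ?_⟩
      calc ∑ k ∈ Finset.range (n + 1), 2 / (((k : ℝ) + 2) * (k + 3)) * renewalCoeff (n - k)
          ≤ ∑ k ∈ Finset.range (n + 1), 2 / (((k : ℝ) + 2) * (k + 3)) * 2 :=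
            Finset.sum_le_sum fun k _ =>
              mul_le_mul_of_nonneg_left (ih _ (by omega)).2 (by positivity)
        _ ≤ 2 := by
            rw [← Finset.sum_mul, sum_renewal_weights]
            have : (0 : ℝ) ≤ 2 / (((n + 1 : ℕ) : ℝ) + 2) := by positivity
            linarith

theorem logCoeff_mem_Icc (n : ℕ) : 0 ≤ logCoeff n ∧ logCoeff n ≤ 1 := by
  cases n with
  | zero => simp [logCoeff]
  | succ n =>
    rw [logCoeff]
    refine ⟨by positivity, ?_⟩
    rw [div_le_one (by positivity)]
    have : (0 : ℝ) ≤ n := n.cast_nonneg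
    linarith

theorem abs_renewalCoeff_le (n : ℕ) : |renewalCoeff n| ≤ 2 := by
  rw [abs_of_nonneg (renewalCoeff_mem_Icc n).1]
  exact (renewalCoeff_mem_Icc n).2

theorem abs_logCoeff_le (n : ℕ) : |logCoeff n| ≤ 1 := by
  rw [abs_of_nonneg (logCoeff_mem_Icc n).1]
  exact (logCoeff_mem_Icc n).2

theorem abs_renewalCoeff_sub_le (α : ℝ) (n : ℕ) :
    |renewalCoeff n - α * logCoeff n| ≤ 2 + |α| := by
  refine (abs_sub _ _).trans (add_le_add (abs_renewalCoeff_le n) ?_)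
  rw [abs_mul]
  exact mul_le_of_le_one_right (abs_nonneg α) (abs_logCoeff_le n)

theorem sum_renewalCoeff_div (n : ℕ) :
    ∑ k ∈ Finset.range (n + 1), renewalCoeff (n - k) / ((k : ℝ) + 2) = 1 := by
  induction n with
  | zero => simp [renewalCoeff_zero]
  | succ n ih =>
    rw [Finset.sum_range_succ', ← ih, Nat.sub_zero, renewalCoeff_succ, Finset.sum_div,
      ← Finset.sum_add_distrib]
    refine Finset.sum_congr rfl fun k _ => ?_
    rw [Nat.add_sub_add_right]
    push_cast
    field_simp
    ring

theorem sum_antidiagonal_renewalCoeff_mul_logCoeff (n : ℕ) :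
    ∑ kl ∈ Finset.HasAntidiagonal.antidiagonal (n + 1), logCoeff kl.1 * renewalCoeff kl.2 = 1 := by
  rw [Finset.Nat.sum_antidiagonal_eq_sum_range_succ (fun i j => logCoeff i * renewalCoeff j),
    Finset.sum_range_succ', ← sum_renewalCoeff_div n]
  simp only [logCoeff, zero_mul, add_zero, Nat.add_sub_add_right]
  exact Finset.sum_congr rfl fun k _ => by ring

theorem summable_mul_pow {a : ℕ → ℝ} {C : ℝ} (ha : ∀ n, |a n| ≤ C) {v : ℝ} (hv0 : 0 ≤ v)
    (hv1 : v < 1) : Summable fun n => ‖a n * v ^ n‖ := by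
  refine Summable.of_nonneg_of_le (fun _ => norm_nonneg _) (fun n => ?_)
    ((summable_geometric_of_lt_one hv0 hv1).mul_left C)
  rw [norm_mul, Real.norm_eq_abs, Real.norm_of_nonneg (by positivity : 0 ≤ v ^ n)]
  exact mul_le_mul_of_nonneg_right (ha n) (by positivity)

theorem tsum_logCoeff_mul_tsum_renewalCoeff {v : ℝ} (hv0 : 0 ≤ v) (hv1 : v < 1) :
    (∑' n, logCoeff n * v ^ n) * ∑' n, renewalCoeff n * v ^ n = v / (1 - v) := by
  rw [tsum_mul_tsum_eq_tsum_sum_antidiagonal_of_summable_norm (summable_mul_pow abs_logCoeff_le hv0 hv1)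
    (summable_mul_pow abs_renewalCoeff_le hv0 hv1)]
  have e : ∀ n, ∑ kl ∈ Finset.HasAntidiagonal.antidiagonal n,
      logCoeff kl.1 * v ^ kl.1 * (renewalCoeff kl.2 * v ^ kl.2) =
      (∑ kl ∈ Finset.HasAntidiagonal.antidiagonal n, logCoeff kl.1 * renewalCoeff kl.2) * v ^ n := by
    intro n
    rw [Finset.sum_mul]
    refine Finset.sum_congr rfl fun kl hkl => ?_
    rw [← Finset.HasAntidiagonal.mem_antidiagonal.1 hkl, pow_add]
    ring
  simp only [e]
  have hs : HasSum (fun n => (∑ kl ∈ Finset.HasAntidiagonal.antidiagonal (n + 1),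
      logCoeff kl.1 * renewalCoeff kl.2) * v ^ (n + 1)) (v / (1 - v)) := by
    simp only [sum_antidiagonal_renewalCoeff_mul_logCoeff, one_mul, pow_succ', div_eq_mul_inv]
    exact (hasSum_geometric_of_lt_one hv0 hv1).mul_left v
  have h0 := (hasSum_nat_add_iff (f := fun n => (∑ kl ∈ Finset.HasAntidiagonal.antidiagonal n,
      logCoeff kl.1 * renewalCoeff kl.2) * v ^ n) 1).1 hs
  rw [h0.tsum_eq]
  simp [logCoeff]

theorem tsum_logCoeff {v : ℝ} (hv0 : 0 ≤ v) (hv1 : v < 1) :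
    ∑' n, logCoeff n * v ^ (n + 1) = -Real.log (1 - v) - v := by
  have h := Real.hasSum_pow_div_log_of_abs_lt_one (x := v) (by rwa [abs_of_nonneg hv0])
  have h1 := (hasSum_nat_add_iff' 1).2 h
  have h2 : HasSum (fun n => logCoeff (n + 1) * v ^ (n + 1 + 1)) (-Real.log (1 - v) - v) := by
    have e (n : ℕ) : logCoeff (n + 1) * v ^ (n + 1 + 1) =
        v ^ (n + 1 + 1) / (((n + 1 : ℕ) : ℝ) + 1) := by
      rw [logCoeff]
      push_cast
      ring
    simp only [e]
    simpa only [Finset.sum_range_one, zero_add, pow_one, Nat.cast_zero, div_one] using h1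
  have h3 := (hasSum_nat_add_iff (f := fun n => logCoeff n * v ^ (n + 1)) 1).1 h2
  rw [h3.tsum_eq]
  simp [logCoeff]

/-! ### Positivity for `α = 2.188585` -/

theorem two_le_sum_weighted {N : ℕ} (hN : 8 ≤ N) :
    2 ≤ ∑ k ∈ Finset.range N, 2 / (((k : ℝ) + 2) * (k + 3)) * (k + 1) := by
  calc (2 : ℝ) ≤ ∑ k ∈ Finset.range 8, 2 / (((k : ℝ) + 2) * (k + 3)) * (k + 1) := by
        norm_num [Finset.sum_range_succ]
    _ ≤ _ := Finset.sum_le_sum_of_subset_of_nonneg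
        (Finset.range_subset_range.2 hN) fun k _ _ => by positivity

theorem renewalCoeff_values :
    renewalCoeff 1 = 2 / 3 ∧
    renewalCoeff 2 = 5 / 9 ∧
    renewalCoeff 3 = 67 / 135 ∧
    renewalCoeff 4 = 371 / 810 ∧
    renewalCoeff 5 = 1465 / 3402 ∧
    renewalCoeff 6 = 209081 / 510300 ∧
    renewalCoeff 7 = 85961 / 218700 ∧
    renewalCoeff 8 = 3484393 / 9185400 ∧
    renewalCoeff 9 = 557408227 / 1515591000 ∧
    renewalCoeff 10 = 4555877041 / 12730964400 ∧
    renewalCoeff 11 = 78810586873 / 225685278000 ∧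
    renewalCoeff 12 = 25438717237553 / 74476141740000 ∧
    renewalCoeff 13 = 5753410810493 / 17186801940000 ∧
    renewalCoeff 14 = 8990828950381 / 27358582680000 ∧
    renewalCoeff 15 = 773088500444498089 / 2392918434106200000 ∧
    renewalCoeff 16 = 4565742027259736483 / 14357510604637200000 ∧
    renewalCoeff 17 = 430990619042668799 / 1375425385654320000 := by
  have h0 := renewalCoeff_zero
  have h1 : renewalCoeff 1 = 2 / 3 := by
    rw [renewalCoeff_succ]
    norm_num [Finset.sum_range_succ, h0]
  have h2 : renewalCoeff 2 = 5 / 9 := by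
    rw [renewalCoeff_succ]
    norm_num [Finset.sum_range_succ, h0, h1]
  have h3 : renewalCoeff 3 = 67 / 135 := by
    rw [renewalCoeff_succ]
    norm_num [Finset.sum_range_succ, h0, h1, h2]
  have h4 : renewalCoeff 4 = 371 / 810 := by
    rw [renewalCoeff_succ]
    norm_num [Finset.sum_range_succ, h0, h1, h2, h3]
  have h5 : renewalCoeff 5 = 1465 / 3402 := by
    rw [renewalCoeff_succ]
    norm_num [Finset.sum_range_succ, h0, h1, h2, h3, h4]
  have h6 : renewalCoeff 6 = 209081 / 510300 := by
    rw [renewalCoeff_succ]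
    norm_num [Finset.sum_range_succ, h0, h1, h2, h3, h4, h5]
  have h7 : renewalCoeff 7 = 85961 / 218700 := by
    rw [renewalCoeff_succ]
    norm_num [Finset.sum_range_succ, h0, h1, h2, h3, h4, h5, h6]
  have h8 : renewalCoeff 8 = 3484393 / 9185400 := by
    rw [renewalCoeff_succ]
    norm_num [Finset.sum_range_succ, h0, h1, h2, h3, h4, h5, h6, h7]
  have h9 : renewalCoeff 9 = 557408227 / 1515591000 := by
    rw [renewalCoeff_succ]
    norm_num [Finset.sum_range_succ, h0, h1, h2, h3, h4, h5, h6, h7, h8]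
  have h10 : renewalCoeff 10 = 4555877041 / 12730964400 := by
    rw [renewalCoeff_succ]
    norm_num [Finset.sum_range_succ, h0, h1, h2, h3, h4, h5, h6, h7, h8, h9]
  have h11 : renewalCoeff 11 = 78810586873 / 225685278000 := by
    rw [renewalCoeff_succ]
    norm_num [Finset.sum_range_succ, h0, h1, h2, h3, h4, h5, h6, h7, h8, h9, h10]
  have h12 : renewalCoeff 12 = 25438717237553 / 74476141740000 := by
    rw [renewalCoeff_succ]
    norm_num [Finset.sum_range_succ, h0, h1, h2, h3, h4, h5, h6, h7, h8, h9, h10, h11]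
  have h13 : renewalCoeff 13 = 5753410810493 / 17186801940000 := by
    rw [renewalCoeff_succ]
    norm_num [Finset.sum_range_succ, h0, h1, h2, h3, h4, h5, h6, h7, h8, h9, h10, h11, h12]
  have h14 : renewalCoeff 14 = 8990828950381 / 27358582680000 := by
    rw [renewalCoeff_succ]
    norm_num [Finset.sum_range_succ, h0, h1, h2, h3, h4, h5, h6, h7, h8, h9, h10, h11, h12, h13]
  have h15 : renewalCoeff 15 = 773088500444498089 / 2392918434106200000 := by
    rw [renewalCoeff_succ]
    norm_num [Finset.sum_range_succ, h0, h1, h2, h3, h4, h5, h6, h7, h8, h9, h10, h11, h12, h13, h14]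
  have h16 : renewalCoeff 16 = 4565742027259736483 / 14357510604637200000 := by
    rw [renewalCoeff_succ]
    norm_num [Finset.sum_range_succ, h0, h1, h2, h3, h4, h5, h6, h7, h8, h9, h10, h11, h12, h13, h14, h15]
  have h17 : renewalCoeff 17 = 430990619042668799 / 1375425385654320000 := by
    rw [renewalCoeff_succ]
    norm_num [Finset.sum_range_succ, h0, h1, h2, h3, h4, h5, h6, h7, h8, h9, h10, h11, h12, h13, h14, h15, h16]
  exact ⟨h1, h2, h3, h4, h5, h6, h7, h8, h9, h10, h11, h12, h13, h14, h15, h16, h17⟩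

theorem renewalCoeff_lower_bound (n : ℕ) : 5 / 2 / ((n : ℝ) + 3) ≤ renewalCoeff n := by
  induction n using Nat.strong_induction_on with
  | _ n ih =>
    obtain hn | hn := lt_or_ge n 8
    · obtain ⟨h1, h2, h3, h4, h5, h6, h7, -⟩ := renewalCoeff_values
      interval_cases n <;> norm_num [renewalCoeff_zero, h1, h2, h3, h4, h5, h6, h7]
    · obtain ⟨n, rfl⟩ : ∃ k, n = k + 1 := ⟨n - 1, by omega⟩
      have hw := two_le_sum_weighted hn
      have hp := sum_renewal_weights (n + 1)
      rw [renewalCoeff_succ]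
      have step : ∀ k ∈ Finset.range (n + 1),
          5 / 2 / ((n : ℝ) + 4) * (2 / (((k : ℝ) + 2) * (k + 3)) +
            2 / (((k : ℝ) + 2) * (k + 3)) * (k + 1) / (n + 3)) ≤
          2 / (((k : ℝ) + 2) * (k + 3)) * renewalCoeff (n - k) := by
        intro k hk
        have hkn : k ≤ n := by have := Finset.mem_range.1 hk; omega
        have hle := ih (n - k) (by omega)
        have hkn' : (k : ℝ) ≤ n := by exact_mod_cast hkn
        have hk0 : (0 : ℝ) ≤ k := k.cast_nonneg
        rw [Nat.cast_sub hkn] at hle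
        have h1 : 5 / 2 / ((n : ℝ) + 4) * (1 + (k + 1) / (n + 3)) ≤ 5 / 2 / ((n : ℝ) - k + 3) := by
          have : 5 / 2 / ((n : ℝ) + 4) * (1 + (k + 1) / (n + 3)) =
              5 / 2 * (n + k + 4) / ((n + 4) * (n + 3)) := by
            field_simp
            ring
          rw [this, div_le_div_iff₀ (by positivity) (by linarith)]
          nlinarith [mul_nonneg hk0 hk0]
        calc _ = 2 / (((k : ℝ) + 2) * (k + 3)) *
              (5 / 2 / ((n : ℝ) + 4) * (1 + (k + 1) / (n + 3))) := by ring
          _ ≤ _ := mul_le_mul_of_nonneg_left (h1.trans hle) (by positivity)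
      refine le_trans ?_ (Finset.sum_le_sum step)
      rw [← Finset.mul_sum, Finset.sum_add_distrib, ← Finset.sum_div, hp]
      push_cast
      rw [show (n : ℝ) + 1 + 3 = n + 4 by ring, show (n : ℝ) + 1 + 2 = n + 3 by ring]
      refine le_mul_of_one_le_right (by positivity) ?_
      have := div_le_div_of_nonneg_right hw (by positivity : (0 : ℝ) ≤ n + 3)
      linarith

theorem mul_cube_sub_self_le_pow_sub_self {y : ℝ} (hy : 0 ≤ y) {n : ℕ} (hn : 3 ≤ n) :
    ((n : ℝ) - 1) / 2 * (y ^ 3 - y) ≤ y ^ n - y := by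
  induction n, hn using Nat.le_induction with
  | base => norm_num
  | succ n hn ih =>
    have h1 : y ^ 3 * (y - 1) ≤ y ^ n * (y - 1) := by
      obtain h | h := le_total y 1
      · exact mul_le_mul_of_nonpos_right (pow_le_pow_of_le_one hy h hn) (by linarith)
      · exact mul_le_mul_of_nonneg_right (pow_le_pow_right₀ h hn) (by linarith)
    have h2 : 0 ≤ y * (y - 1) ^ 2 * (2 * y + 1) := by positivity
    push_cast
    rw [pow_succ y n]
    nlinarith

/-- Among nonnegative powers, `y` and `y ^ 3` dominate `y ^ 2` and are dominated by the rest. -/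
theorem sum_mul_pow_nonneg {c : ℕ → ℝ} {N : ℕ} (h0 : 0 ≤ c 0) (h2 : c 2 ≤ 0)
    (h : ∀ n, 4 ≤ n → n < N → 0 ≤ c n)
    (hA : 0 ≤ ∑ n ∈ Finset.range N, c n * ((3 - n) / 2))
    (hB : 0 ≤ ∑ n ∈ Finset.range N, c n * ((n - 1) / 2)) {y : ℝ} (hy : 0 ≤ y) :
    0 ≤ ∑ n ∈ Finset.range N, c n * y ^ n := by
  calc 0 ≤ (∑ n ∈ Finset.range N, c n * ((3 - n) / 2)) * y +
        (∑ n ∈ Finset.range N, c n * ((n - 1) / 2)) * y ^ 3 := by positivity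
    _ = ∑ n ∈ Finset.range N, c n * (y + ((n : ℝ) - 1) / 2 * (y ^ 3 - y)) := by
        rw [Finset.sum_mul, Finset.sum_mul, ← Finset.sum_add_distrib]
        exact Finset.sum_congr rfl fun n _ => by ring
    _ ≤ _ := by
        refine Finset.sum_le_sum fun n hn => ?_
        obtain hn3 | hn3 := lt_or_ge n 4
        · interval_cases n
          · refine mul_le_mul_of_nonneg_left ?_ h0
            norm_num
            nlinarith [mul_nonneg (sq_nonneg (y - 1)) (by linarith : 0 ≤ y + 2)]
          · norm_num
          · refine mul_le_mul_of_nonpos_left ?_ h2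
            norm_num
            nlinarith [mul_nonneg (sq_nonneg (y - 1)) hy]
          · norm_num
        · refine mul_le_mul_of_nonneg_left ?_ (h n hn3 (Finset.mem_range.1 hn))
          linarith [mul_cube_sub_self_le_pow_sub_self hy (by omega : 3 ≤ n)]

theorem mul_logCoeff_le_renewalCoeff {n : ℕ} (hn : 4 ≤ n) :
    2.188585 * logCoeff n ≤ renewalCoeff n := by
  obtain hn' | hn' := lt_or_ge n 14
  · obtain ⟨h1, h2, h3, h4, h5, h6, h7, h8, h9, h10, h11, h12, h13, -⟩ := renewalCoeff_values
    interval_cases n <;>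
      norm_num [logCoeff, h4, h5, h6, h7, h8, h9, h10, h11, h12, h13]
  · refine le_trans ?_ (renewalCoeff_lower_bound n)
    obtain ⟨n, rfl⟩ : ∃ k, n = k + 1 := ⟨n - 1, by omega⟩
    have h : (13 : ℝ) ≤ n := by exact_mod_cast (by omega : 13 ≤ n)
    rw [logCoeff, mul_one_div, div_le_div_iff₀ (by positivity) (by positivity)]
    push_cast
    linarith

theorem expGenFun_sub_nonneg {t : ℝ} (ht : 0 < t) :
    0 ≤ expGenFun (fun n => renewalCoeff n - 2.188585 * logCoeff n) t := by
  have hpos : ∀ n, 4 ≤ n → 0 ≤ renewalCoeff n - 2.188585 * logCoeff n := fun n hn =>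
    sub_nonneg.2 (mul_logCoeff_le_renewalCoeff hn)
  have hle : ∑ n ∈ Finset.range 18,
      (renewalCoeff n - 2.188585 * logCoeff n) * (t ^ n / (n ! : ℝ)) ≤
      expGenFun (fun n => renewalCoeff n - 2.188585 * logCoeff n) t := by
    refine (summable_expGenFun (abs_renewalCoeff_sub_le 2.188585) t).sum_le_tsum _ fun n hn => ?_
    have hn' : 18 ≤ n := by simpa using hn
    exact mul_nonneg (hpos n (by omega)) (by positivity)
  refine le_trans ?_ hle
  obtain ⟨h1, h2, h3, h4, h5, h6, h7, h8, h9, h10, h11, h12, h13, h14, h15, h16, h17⟩ :=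
    renewalCoeff_values
  have key := sum_mul_pow_nonneg (N := 18) (y := t / 3.365562)
    (c := fun n => (renewalCoeff n - 2.188585 * logCoeff n) * (3.365562 ^ n / (n ! : ℝ)))
    ?_ ?_ (fun n hn _ => mul_nonneg (hpos n hn) (by positivity)) ?_ ?_ (by positivity)
  · refine key.trans_eq (Finset.sum_congr rfl fun n _ => ?_)
    rw [div_pow]
    field_simp
  · norm_num [renewalCoeff_zero, logCoeff]
  · norm_num [h2, logCoeff, Nat.factorial]
  · norm_num [Finset.sum_range_succ, renewalCoeff_zero, logCoeff, Nat.factorial, h1, h2, h3, h4, h5, h6, h7, h8, h9, h10, h11, h12, h13, h14, h15, h16, h17]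
  · norm_num [Finset.sum_range_succ, renewalCoeff_zero, logCoeff, Nat.factorial, h1, h2, h3, h4, h5, h6, h7, h8, h9, h10, h11, h12, h13, h14, h15, h16, h17]

theorem expGenFun_le_sum_add {a : ℕ → ℝ} {C : ℝ} (ha : ∀ n, |a n| ≤ C) {t : ℝ} (ht : 0 ≤ t)
    (N : ℕ) (htN : t < N + 1) :
    expGenFun a t ≤ ∑ n ∈ Finset.range N, a n * (t ^ n / (n ! : ℝ)) +
      C * (t ^ N / (N ! : ℝ)) * (1 - t / (N + 1))⁻¹ := by
  have hs := summable_expGenFun ha t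
  have hC : 0 ≤ C := (abs_nonneg _).trans (ha 0)
  have hr0 : 0 ≤ t / ((N : ℝ) + 1) := by positivity
  have hr1 : t / ((N : ℝ) + 1) < 1 := by
    rw [div_lt_one (by positivity)]
    exact htN
  rw [expGenFun, ← hs.sum_add_tsum_nat_add N, ← tsum_geometric_of_lt_one hr0 hr1,
    ← tsum_mul_left]
  refine add_le_add_right (Summable.tsum_le_tsum (fun n => ?_) ((summable_nat_add_iff N).2 hs)
    ((summable_geometric_of_lt_one hr0 hr1).mul_left _)) _
  have hfac : (N ! : ℝ) * ((N : ℝ) + 1) ^ n ≤ ((n + N)! : ℝ) := by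
    rw [add_comm n N]
    exact_mod_cast Nat.factorial_mul_pow_le_factorial
  calc a (n + N) * (t ^ (n + N) / ((n + N)! : ℝ))
      ≤ C * (t ^ (n + N) / ((N ! : ℝ) * ((N : ℝ) + 1) ^ n)) := by
        refine mul_le_mul ((le_abs_self _).trans (ha _)) ?_ (by positivity) hC
        exact div_le_div_of_nonneg_left (by positivity) (by positivity) hfac
    _ = C * (t ^ N / (N ! : ℝ)) * (t / ((N : ℝ) + 1)) ^ n := by
        rw [pow_add, div_pow]
        field_simp

theorem sum_le_expGenFun_logCoeff {t : ℝ} (ht : 0 ≤ t) (N : ℕ) :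
    ∑ n ∈ Finset.range N, logCoeff n * (t ^ n / (n ! : ℝ)) ≤ expGenFun logCoeff t :=
  (summable_expGenFun abs_logCoeff_le t).sum_le_tsum _ fun n _ =>
    mul_nonneg (logCoeff_mem_Icc n).1 (by positivity)

theorem expGenFun_logCoeff_pos {t : ℝ} (ht : 0 < t) : 0 < expGenFun logCoeff t := by
  refine lt_of_lt_of_le ?_ (sum_le_expGenFun_logCoeff ht.le 2)
  norm_num [Finset.sum_range_succ, logCoeff]
  exact ht

theorem expGenFun_renewalCoeff_lt :
    expGenFun renewalCoeff 3.366 < 2.18859 * expGenFun logCoeff 3.366 := by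
  have h1 := expGenFun_le_sum_add abs_renewalCoeff_le (t := 3.366) (by norm_num) 18 (by norm_num)
  have h2 := sum_le_expGenFun_logCoeff (t := 3.366) (by norm_num) 18
  refine h1.trans_lt (lt_of_lt_of_le ?_ (mul_le_mul_of_nonneg_left h2 (by norm_num)))
  obtain ⟨h1, h2, h3, h4, h5, h6, h7, h8, h9, h10, h11, h12, h13, h14, h15, h16, h17⟩ :=
    renewalCoeff_values
  norm_num [Finset.sum_range_succ, renewalCoeff_zero, logCoeff, Nat.factorial, h1, h2, h3, h4, h5, h6, h7, h8, h9, h10, h11, h12, h13, h14, h15, h16, h17]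

theorem expGenFun_sub (α t : ℝ) :
    expGenFun (fun n => renewalCoeff n - α * logCoeff n) t =
      expGenFun renewalCoeff t - α * expGenFun logCoeff t := by
  simp only [expGenFun]
  rw [← tsum_mul_left, ← (summable_expGenFun abs_renewalCoeff_le t).tsum_sub
    ((summable_expGenFun abs_logCoeff_le t).mul_left α)]
  exact tsum_congr fun n => by ring

/-! ### Logarithmic derivative of `h_α′` -/

theorem hasDerivAt_hfun (α : ℝ) {x : ℝ} (hx : 0 < x) :
    HasDerivAt (hfun α) (hfun α x * (α * (Real.log (1 + 1 / x) - 1 / (x + 1)))) x := by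
  have h1 : HasDerivAt (fun x : ℝ => 1 + 1 / x) (-(x ^ 2)⁻¹) x := by
    simpa [one_div] using (hasDerivAt_inv hx.ne').const_add 1
  have h2 := (((hasDerivAt_id x).const_mul α).mul
    (h1.log (by positivity))).exp
  refine h2.congr_deriv ?_
  simp only [hfun, id, Pi.mul_apply]
  field_simp
  ring

theorem hasDerivAt_log_sub {x : ℝ} (hx : 0 < x) :
    HasDerivAt (fun x : ℝ => Real.log (1 + 1 / x) - 1 / (x + 1)) (-(1 / (x * (x + 1) ^ 2))) x := by
  have h1 : HasDerivAt (fun x : ℝ => 1 + 1 / x) (-(x ^ 2)⁻¹) x := by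
    simpa [one_div] using (hasDerivAt_inv hx.ne').const_add 1
  have h2 : HasDerivAt (fun x : ℝ => 1 / (x + 1)) (-1 / (x + 1) ^ 2) x := by
    simpa [one_div] using ((hasDerivAt_id x).add_const (1 : ℝ)).fun_inv (by simp; positivity)
  refine ((h1.log (by positivity)).sub h2).congr_deriv ?_
  field_simp
  ring

theorem neg_deriv_deriv_div_deriv_hfun {α x : ℝ} (hα : α ≠ 0) (hx : 0 < x)
    (hG : Real.log (1 + 1 / x) - 1 / (x + 1) ≠ 0) :
    -deriv (deriv (hfun α)) x / deriv (hfun α) x =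
      1 / (x * (x + 1) ^ 2) / (Real.log (1 + 1 / x) - 1 / (x + 1)) -
        α * (Real.log (1 + 1 / x) - 1 / (x + 1)) := by
  have heq : deriv (hfun α) =ᶠ[𝓝 x]
      fun x => hfun α x * (α * (Real.log (1 + 1 / x) - 1 / (x + 1))) := by
    filter_upwards [Ioi_mem_nhds hx] with y hy using (hasDerivAt_hfun α hy).deriv
  rw [heq.deriv_eq, heq.self_of_nhds,
    ((hasDerivAt_hfun α hx).fun_mul ((hasDerivAt_log_sub hx).const_mul α)).deriv]
  have hh : hfun α x ≠ 0 := (Real.exp_pos _).ne'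
  beta_reduce
  generalize Real.log (1 + 1 / x) - 1 / (x + 1) = G at hG ⊢
  field_simp
  ring

theorem neg_deriv_deriv_div_deriv_hfun_eq_invPowSeries {α x : ℝ} (hα : α ≠ 0) (hx : 0 < x) :
    -deriv (deriv (hfun α)) x / deriv (hfun α) x =
      invPowSeries (fun n => renewalCoeff n - α * logCoeff n) 0 x := by
  set v : ℝ := (x + 1)⁻¹ with hv
  have hv0 : 0 < v := by positivity
  have hv1 : v < 1 := inv_lt_one_of_one_lt₀ (by linarith)
  have h1v : 1 - v = x / (x + 1) := by rw [hv]; field_simp; ring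
  have hlog : ∑' n, logCoeff n * v ^ (n + 1) = Real.log (1 + 1 / x) - 1 / (x + 1) := by
    rw [tsum_logCoeff hv0.le hv1, h1v, ← Real.log_inv, inv_div, hv, one_div (x + 1), add_div,
      div_self hx.ne']
  have hprod : (∑' n, logCoeff n * v ^ (n + 1)) * ∑' n, renewalCoeff n * v ^ (n + 1) =
      1 / (x * (x + 1) ^ 2) := by
    simp only [pow_succ, ← mul_assoc]
    rw [tsum_mul_right, tsum_mul_right, mul_mul_mul_comm,
      tsum_logCoeff_mul_tsum_renewalCoeff hv0.le hv1, h1v, hv]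
    field_simp
  have hG : Real.log (1 + 1 / x) - 1 / (x + 1) ≠ 0 := by
    intro h
    rw [hlog, h, zero_mul] at hprod
    have : 0 < 1 / (x * (x + 1) ^ 2) := by positivity
    exact this.ne hprod
  have hsum {a : ℕ → ℝ} {C : ℝ} (ha : ∀ n, |a n| ≤ C) :
      Summable fun n => a n * v ^ (n + 1) := by
    refine ((summable_mul_pow ha hv0.le hv1).of_norm.mul_right v).congr fun n => ?_
    ring
  rw [neg_deriv_deriv_div_deriv_hfun hα hx hG, ← hprod, hlog, mul_div_cancel_left₀ _ hG, ← hlog,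
    ← tsum_mul_left, ← (hsum abs_renewalCoeff_le).tsum_sub ((hsum abs_logCoeff_le).mul_left α),
    invPowSeries]
  refine tsum_congr fun n => ?_
  have := Nat.factorial_ne_zero n
  rw [add_zero, div_self (by positivity), ← inv_pow]
  ring

theorem completelyMonotonicOn_neg_deriv_deriv_div_deriv_hfun_iff {α : ℝ} (hα : α ≠ 0) :
    CompletelyMonotonicOn (fun x => -deriv (deriv (hfun α)) x / deriv (hfun α) x) ↔
      ∀ t > 0, α ≤ expGenFun renewalCoeff t / expGenFun logCoeff t := by
  rw [completelyMonotonicOn_congr fun x hx =>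
      neg_deriv_deriv_div_deriv_hfun_eq_invPowSeries hα hx,
    completelyMonotonicOn_invPowSeries_iff_expGenFun_nonneg (abs_renewalCoeff_sub_le α)]
  refine forall₂_congr fun t ht => ?_
  rw [expGenFun_sub, sub_nonneg, le_div_iff₀ (expGenFun_logCoeff_pos ht)]

/-- There is `β*` with `2.188585 ≤ β* < 2.18859` such that, for every `α > 0`,
`−h_α″/h_α′` is completely monotonic on `(0,∞)` (i.e. `h_α′` is logarithmically
completely monotonic) if and only if `α ≤ β*`. -/
theorem exists_beta_star :
    ∃ β : ℝ, 2.188585 ≤ β ∧ β < 2.18859 ∧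
      ∀ α : ℝ, 0 < α →
        (CompletelyMonotonicOn
            (fun x => -deriv (deriv (hfun α)) x / deriv (hfun α) x) ↔ α ≤ β) := by
  set S : Set ℝ := (fun t => expGenFun renewalCoeff t / expGenFun logCoeff t) '' Ioi 0
  have hlow : ∀ s ∈ S, (2.188585 : ℝ) ≤ s := by
    rintro _ ⟨t, ht, rfl⟩
    have h := expGenFun_sub_nonneg ht
    rw [expGenFun_sub, sub_nonneg] at h
    exact (le_div_iff₀ (expGenFun_logCoeff_pos ht)).2 h
  have hbdd : BddBelow S := ⟨_, hlow⟩
  have hne : S.Nonempty := nonempty_Ioi.image _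
  refine ⟨sInf S, le_csInf hne hlow, ?_, fun α hα => ?_⟩
  · have ht : (0 : ℝ) < 3.366 := by norm_num
    refine (csInf_le hbdd (mem_image_of_mem _ ht)).trans_lt ?_
    rw [div_lt_iff₀ (expGenFun_logCoeff_pos ht)]
    exact expGenFun_renewalCoeff_lt
  · rw [completelyMonotonicOn_neg_deriv_deriv_div_deriv_hfun_iff hα.ne',
      le_csInf_iff hbdd hne, forall_mem_image]
    rfl
end
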